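/- There exists a constant C > 0 such that for every positive integer n, all positive integers q_1, …, q_{n+1} with 2q_j dividing q_{j+1} for j = 1, …, n, and every integer p coprime to q_{n+1}, the counting function N_n(x) = #{k ∈ {1, …, q_{n+1}} : m_n(x + k·p/q_{n+1}) = m_n(x)} satisfies the Renyi inequality ∫_𝕋 N_n² dλ ≤ C·(∫_𝕋 N_n dλ)². -/

import Mathlib

open MeasureTheory

/-- The Haar function `T : 𝕋 → ℤ`, equal to `1` on `[0,1/2)` and `-1` on `[1/2,1)`. -/
noncomputable def haarT (x : UnitAddCircle) : ℤ :=
  if (AddCircle.equivIco 1 0 x : ℝ) < 1/2 then 1 else -1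

/-- `m_n(x) = T(q_1 x) + ⋯ + T(q_n x)` (here `q j`, `j < n`, stands for the paper's `q_{j+1}`). -/
noncomputable def mSum (q : ℕ → ℕ) (n : ℕ) (x : UnitAddCircle) : ℤ :=
  ∑ j ∈ Finset.range n, haarT (q j • x)

/-- The counting function
`N_n(x) = #{k ∈ {1, …, q_{n+1}} : m_n(x + k·p/q_{n+1}) = m_n(x)}`
(here `q n` is the paper's `q_{n+1}`). -/
noncomputable def countN (q : ℕ → ℕ) (n : ℕ) (p : ℤ) (x : UnitAddCircle) : ℕ :=
  {k : ℕ | k ∈ Finset.Icc 1 (q n) ∧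
    mSum q n (x + (((k : ℝ) * (p : ℝ) / (q n : ℝ) : ℝ) : UnitAddCircle)) = mSum q n x}.ncard

/-- The expectation of `F` at the `n`-th step of the simple random walk on `ℤ`. -/
noncomputable def walkMean (n : ℕ) (F : ℤ → ℝ) : ℝ :=
  (∑ i ∈ Finset.range (n + 1), (n.choose i : ℝ) * F ((i : ℤ) - ((n - i : ℕ) : ℤ))) / 2 ^ n

/-- The probability that the simple random walk on `ℤ` is at `z` at time `n`. -/
noncomputable def walkProb (n : ℕ) (z : ℤ) : ℝ :=
  walkMean n fun w => if w = z then 1 else 0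

theorem walkMean_zero (F : ℤ → ℝ) : walkMean 0 F = F 0 := by
  simp [walkMean]

theorem walkMean_succ (n : ℕ) (F : ℤ → ℝ) :
    walkMean (n + 1) F =
      (walkMean n (fun z => F (z + 1)) + walkMean n (fun z => F (z - 1))) / 2 := by
  have h := Finset.sum_choose_succ_nsmul (fun i j : ℕ => F ((i : ℤ) - (j : ℤ))) n
  simp only [nsmul_eq_mul] at h
  have h₁ : ∀ i ∈ Finset.range (n + 1),
      (n.choose i : ℝ) * F ((i : ℤ) - ((n + 1 - i : ℕ) : ℤ)) =
        n.choose i * F ((i : ℤ) - ((n - i : ℕ) : ℤ) - 1) := by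
    intro i hi
    have hi := Finset.mem_range.1 hi
    congr 2
    omega
  have h₂ : ∀ i ∈ Finset.range (n + 1),
      (n.choose i : ℝ) * F (((i + 1 : ℕ) : ℤ) - ((n - i : ℕ) : ℤ)) =
        n.choose i * F ((i : ℤ) - ((n - i : ℕ) : ℤ) + 1) := by
    intro i _
    congr 2
    push_cast
    ring
  rw [Finset.sum_congr rfl h₁, Finset.sum_congr rfl h₂] at h
  simp only [walkMean]
  rw [h, pow_succ]
  field_simp
  ring

theorem walkMean_nonneg (n : ℕ) {F : ℤ → ℝ} (hF : ∀ z, 0 ≤ F z) : 0 ≤ walkMean n F :=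
  div_nonneg (Finset.sum_nonneg fun _ _ => mul_nonneg (Nat.cast_nonneg _) (hF _)) (by positivity)

theorem walkMean_mono (n : ℕ) {F G : ℤ → ℝ} (h : ∀ z, F z ≤ G z) :
    walkMean n F ≤ walkMean n G := by
  unfold walkMean
  gcongr
  exact h _

theorem walkMean_const_mul (n : ℕ) (c : ℝ) (F : ℤ → ℝ) :
    walkMean n (fun z => c * F z) = c * walkMean n F := by
  unfold walkMean
  rw [← mul_div_assoc, Finset.mul_sum]
  congr 1
  exact Finset.sum_congr rfl fun _ _ => by ring

theorem walkProb_nonneg (n : ℕ) (z : ℤ) : 0 ≤ walkProb n z :=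
  walkMean_nonneg n fun w => by split_ifs <;> norm_num

theorem walkProb_position {n i : ℕ} (hi : i ≤ n) :
    walkProb n ((i : ℤ) - ((n - i : ℕ) : ℤ)) = n.choose i / 2 ^ n := by
  unfold walkProb walkMean
  rw [Finset.sum_eq_single_of_mem i (Finset.mem_range.2 (by omega))]
  · simp
  · intro j hj hne
    have hj := Finset.mem_range.1 hj
    simp only [if_neg (show ¬((j : ℤ) - ((n - j : ℕ) : ℤ) = (i : ℤ) - ((n - i : ℕ) : ℤ)) by omega), mul_zero]

theorem walkProb_le_middle (n : ℕ) (z : ℤ) : walkProb n z ≤ n.choose (n / 2) / 2 ^ n := by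
  by_cases h : ∃ i ≤ n, (i : ℤ) - ((n - i : ℕ) : ℤ) = z
  · obtain ⟨i, hi, rfl⟩ := h
    rw [walkProb_position hi]
    gcongr
    exact Nat.choose_le_middle i n
  · push Not at h
    have h₀ : walkProb n z = 0 := by
      unfold walkProb walkMean
      rw [Finset.sum_eq_zero, zero_div]
      intro i hi
      simp only [if_neg (h i (by have := Finset.mem_range.1 hi; omega)), mul_zero]
    rw [h₀]
    positivity

theorem walkMean_walkProb (n : ℕ) :
    walkMean n (walkProb n) = n.centralBinom / 4 ^ n := by
  have h : ∑ i ∈ Finset.range (n + 1),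
      (n.choose i : ℝ) * walkProb n ((i : ℤ) - ((n - i : ℕ) : ℤ)) = n.centralBinom / 2 ^ n := by
    rw [Nat.centralBinom, ← Nat.sum_range_choose_sq, Nat.cast_sum, Finset.sum_div]
    refine Finset.sum_congr rfl fun i hi => ?_
    rw [walkProb_position (by have := Finset.mem_range.1 hi; omega)]
    push_cast
    ring
  unfold walkMean
  rw [h, div_div, ← mul_pow]
  norm_num

theorem centralBinom_div_four_pow_succ (m : ℕ) :
    ((m + 1).centralBinom : ℝ) / 4 ^ (m + 1) =
      (m.centralBinom : ℝ) / 4 ^ m * ((2 * m + 1) / (2 * m + 2)) := by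
  have h : ((m : ℝ) + 1) * (m + 1).centralBinom = 2 * (2 * m + 1) * m.centralBinom := by
    exact_mod_cast Nat.succ_mul_centralBinom_succ m
  rw [pow_succ]
  field_simp
  linear_combination 2 * h

theorem sq_centralBinom_div_four_pow_le (m : ℕ) :
    (2 * m + 1) * ((m.centralBinom : ℝ) / 4 ^ m) ^ 2 ≤ 1 := by
  induction m with
  | zero => simp
  | succ m ih =>
    rw [centralBinom_div_four_pow_succ]
    refine le_trans ?_ ih
    set c := (m.centralBinom : ℝ) / 4 ^ m
    have h : (2 * ((m + 1 : ℕ) : ℝ) + 1) * ((2 * m + 1) / (2 * m + 2)) ^ 2 ≤ 2 * m + 1 := by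
      rw [div_pow, ← mul_div_assoc, div_le_iff₀ (by positivity)]
      push_cast
      nlinarith [(Nat.cast_nonneg m : (0 : ℝ) ≤ m)]
    nlinarith [mul_le_mul_of_nonneg_right h (sq_nonneg c)]

theorem one_le_sq_centralBinom_div_four_pow {m : ℕ} (hm : 0 < m) :
    1 ≤ 4 * m * ((m.centralBinom : ℝ) / 4 ^ m) ^ 2 := by
  induction m, hm using Nat.le_induction with
  | base => norm_num [Nat.centralBinom, Nat.choose]
  | succ m hm ih =>
    rw [centralBinom_div_four_pow_succ]
    refine ih.trans ?_
    set c := (m.centralBinom : ℝ) / 4 ^ m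
    have h : 4 * (m : ℝ) ≤ 4 * ((m + 1 : ℕ) : ℝ) * ((2 * m + 1) / (2 * m + 2)) ^ 2 := by
      rw [div_pow, ← mul_div_assoc, le_div_iff₀ (by positivity)]
      push_cast
      nlinarith [(Nat.cast_nonneg m : (0 : ℝ) ≤ m)]
    nlinarith [mul_le_mul_of_nonneg_right h (sq_nonneg c)]

theorem sq_choose_middle_div_two_pow_le (n : ℕ) :
    (n + 1) * ((n.choose (n / 2) : ℝ) / 2 ^ n) ^ 2 ≤ 1 := by
  obtain ⟨m, rfl | rfl⟩ := n.even_or_odd'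
  · have h := sq_centralBinom_div_four_pow_le m
    rw [Nat.mul_div_cancel_left m two_pos, pow_mul]
    norm_num
    exact h
  · have h := sq_centralBinom_div_four_pow_le (m + 1)
    have hc : (m + 1).centralBinom = 2 * (2 * m + 1).choose m := by
      rw [Nat.centralBinom, show 2 * (m + 1) = 2 * m + 1 + 1 by ring, Nat.choose_succ_succ',
        Nat.choose_symm_half]
      ring
    have he : ((m + 1).centralBinom : ℝ) / 4 ^ (m + 1) =
        ((2 * m + 1).choose m : ℝ) / 2 ^ (2 * m + 1) := by
      rw [hc, pow_succ, pow_succ, pow_mul]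
      push_cast
      norm_num
      field_simp
      ring
    rw [he] at h
    rw [show (2 * m + 1) / 2 = m by omega]
    push_cast at h ⊢
    nlinarith [sq_nonneg (((2 * m + 1).choose m : ℝ) / 2 ^ (2 * m + 1))]

theorem choose_middle_le_two_mul_centralBinom {n : ℕ} (hn : 0 < n) :
    (n.choose (n / 2) : ℝ) / 2 ^ n ≤ 2 * ((n.centralBinom : ℝ) / 4 ^ n) := by
  have h₁ := sq_choose_middle_div_two_pow_le n
  have h₂ := one_le_sq_centralBinom_div_four_pow hn
  set a := (n.choose (n / 2) : ℝ) / 2 ^ n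
  set c := (n.centralBinom : ℝ) / 4 ^ n
  have hc₀ : 0 ≤ c := by positivity
  have hn₀ : (0 : ℝ) < n := by exact_mod_cast hn
  refine le_of_sq_le_sq ?_ (by positivity)
  refine le_of_mul_le_mul_left ?_ hn₀
  nlinarith [sq_nonneg a]

theorem walkMean_walkProb_sq_le {n : ℕ} (hn : 0 < n) :
    walkMean n (fun z => walkProb n z ^ 2) ≤ 2 * walkMean n (walkProb n) ^ 2 := by
  calc walkMean n (fun z => walkProb n z ^ 2)
      ≤ walkMean n (fun z => 2 * walkMean n (walkProb n) * walkProb n z) := by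
        refine walkMean_mono n fun z => ?_
        rw [sq, walkMean_walkProb]
        exact mul_le_mul_of_nonneg_right
          ((walkProb_le_middle n z).trans (choose_middle_le_two_mul_centralBinom hn))
          (walkProb_nonneg n z)
    _ = 2 * walkMean n (walkProb n) ^ 2 := by
        rw [walkMean_const_mul]
        ring

theorem haarT_eq_one_or (x : UnitAddCircle) : haarT x = 1 ∨ haarT x = -1 := by
  unfold haarT
  split_ifs <;> simp

theorem haarT_coe (x : ℝ) : haarT (x : UnitAddCircle) = if Int.fract x < 1 / 2 then 1 else -1 := by
  unfold haarT
  rw [AddCircle.coe_equivIco_mk_apply]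
  simp

theorem haarT_add_half (x : UnitAddCircle) :
    haarT (x + ((1 / 2 : ℝ) : UnitAddCircle)) = -haarT x := by
  induction x using QuotientAddGroup.induction_on with
  | H x =>
    change haarT ((x : UnitAddCircle) + ((1 / 2 : ℝ) : UnitAddCircle)) = -haarT (x : UnitAddCircle)
    rw [← AddCircle.coe_add, haarT_coe, haarT_coe]
    have h₀ := Int.fract_nonneg x
    have h₁ := Int.fract_lt_one x
    by_cases h : Int.fract x < 1 / 2
    · have : Int.fract (x + 1 / 2) = Int.fract x + 1 / 2 := by
        rw [Int.fract_eq_iff]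
        exact ⟨by linarith, by linarith, ⌊x⌋, by rw [Int.fract]; ring⟩
      rw [this, if_pos h, if_neg (by linarith)]
    · have : Int.fract (x + 1 / 2) = Int.fract x - 1 / 2 := by
        rw [Int.fract_eq_iff]
        exact ⟨by linarith, by linarith, ⌊x⌋ + 1, by rw [Int.fract]; push_cast; ring⟩
      rw [this, if_neg h, if_pos (by linarith)]
      simp

theorem measurable_haarT : Measurable haarT := by
  unfold haarT
  refine Measurable.ite (measurableSet_lt ?_ measurable_const) measurable_const measurable_const
  exact measurable_subtype_coe.comp (AddCircle.measurableEquivIco 1 0).measurable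

theorem measurable_mSum (q : ℕ → ℕ) (n : ℕ) : Measurable (mSum q n) := by
  unfold mSum
  exact Finset.measurable_sum _ fun j _ =>
    measurable_haarT.comp (continuous_nsmul (q j)).measurable

theorem abs_mSum_le (q : ℕ → ℕ) (n : ℕ) (x : UnitAddCircle) : |mSum q n x| ≤ n := by
  unfold mSum
  refine (Finset.abs_sum_le_sum_abs _ _).trans ?_
  refine (Finset.sum_le_card_nsmul _ _ 1 fun j _ => ?_).trans (by simp)
  rcases haarT_eq_one_or (q j • x) with h | h <;> simp [h]

theorem sum_range_mul_add {M : Type*} [AddCommMonoid M] (g : ℕ → M) (a m : ℕ) :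
    ∑ k ∈ Finset.range (a * m), g k =
      ∑ i ∈ Finset.range a, ∑ j ∈ Finset.range m, g (i * m + j) := by
  induction a with
  | zero => simp
  | succ a ih => rw [Nat.succ_mul, Finset.sum_range_add, ih, Finset.sum_range_succ]

theorem sum_haarT_equidistributed {r : ℕ} (hr : 0 < r) (G : ℤ → ℝ) (y : UnitAddCircle) :
    ∑ b ∈ Finset.range (2 * r),
        G (haarT (y + ((b / (2 * r : ℕ) : ℝ) : UnitAddCircle))) = r * (G 1 + G (-1)) := by
  have hr₀ : (r : ℝ) ≠ 0 := by positivity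
  rw [two_mul r, Finset.sum_range_add, ← Finset.sum_add_distrib]
  rw [Finset.sum_congr rfl (g := fun _ => G 1 + G (-1)), Finset.sum_const, Finset.card_range,
    nsmul_eq_mul]
  intro b _
  have h : ((((r + b : ℕ) : ℝ) / (r + r : ℕ) : ℝ) : UnitAddCircle) =
      ((b / (r + r : ℕ) : ℝ) : UnitAddCircle) + ((1 / 2 : ℝ) : UnitAddCircle) := by
    rw [← AddCircle.coe_add]
    congr 1
    push_cast
    field_simp
    ring
  rw [h, ← add_assoc, haarT_add_half]
  rcases haarT_eq_one_or (y + ((b / (r + r : ℕ) : ℝ) : UnitAddCircle)) with h | h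
  · rw [h]
  · rw [h, neg_neg, add_comm]

/-- Along each coset of the subgroup of order `q n`, the sum `mSum q n` is distributed as the
simple random walk at time `n`. -/
theorem sum_mSum_translates {q : ℕ → ℕ} {n : ℕ} (hpos : ∀ j ≤ n, 0 < q j)
    (hdvd : ∀ j < n, 2 * q j ∣ q (j + 1)) (F : ℤ → ℝ) (x : UnitAddCircle) :
    ∑ k ∈ Finset.range (q n), F (mSum q n (x + ((k / q n : ℝ) : UnitAddCircle))) =
      q n * walkMean n F := by
  induction n generalizing F x with
  | zero => simp [mSum, walkMean_zero]
  | succ n ih =>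
    obtain ⟨r, hr⟩ := hdvd n n.lt_succ_self
    have hq := hpos n n.le_succ
    have hr₀ : 0 < r := by
      have := hpos (n + 1) le_rfl
      rw [hr] at this
      exact pos_of_mul_pos_right this (Nat.zero_le _)
    have hqr : q (n + 1) = q n * (2 * r) := by rw [hr]; ring
    have hq' : (q n : ℝ) ≠ 0 := by positivity
    have hr' : (r : ℝ) ≠ 0 := by positivity
    have ih := ih (fun j hj => hpos j (hj.trans n.le_succ))
      (fun j hj => hdvd j (hj.trans n.lt_succ_self))
    have hshift : ∀ a b : ℕ, x + ((((a * (2 * r) + b : ℕ) : ℝ) / q (n + 1) : ℝ) : UnitAddCircle) =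
        x + ((b / q (n + 1) : ℝ) : UnitAddCircle) + ((a / q n : ℝ) : UnitAddCircle) := by
      intro a b
      rw [add_assoc, ← AddCircle.coe_add]
      congr 2
      rw [hqr]
      push_cast
      field_simp
      ring
    have hstep : ∀ a b : ℕ,
        q n • (x + ((b / q (n + 1) : ℝ) : UnitAddCircle) + ((a / q n : ℝ) : UnitAddCircle)) =
          q n • x + ((b / (2 * r : ℕ) : ℝ) : UnitAddCircle) := by
      intro a b
      rw [smul_add, smul_add, ← AddCircle.coe_nsmul, ← AddCircle.coe_nsmul, nsmul_eq_mul,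
        nsmul_eq_mul, mul_div_cancel₀ _ hq']
      have h₁ : ((a : ℝ) : UnitAddCircle) = 0 := by
        rw [← nsmul_one a, AddCircle.coe_nsmul, AddCircle.coe_period, smul_zero]
      rw [h₁, add_zero, hqr]
      congr 2
      push_cast
      field_simp
    have hm : ∀ a b : ℕ, mSum q (n + 1)
        (x + ((((a * (2 * r) + b : ℕ) : ℝ) / q (n + 1) : ℝ) : UnitAddCircle)) =
        mSum q n (x + ((b / q (n + 1) : ℝ) : UnitAddCircle) + ((a / q n : ℝ) : UnitAddCircle)) +
          haarT (q n • x + ((b / (2 * r : ℕ) : ℝ) : UnitAddCircle)) := by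
      intro a b
      rw [hshift, ← hstep a b, mSum, Finset.sum_range_succ, ← mSum]
    have hcast : (q (n + 1) : ℝ) = q n * (2 * r) := by rw [hqr]; push_cast; ring
    calc ∑ k ∈ Finset.range (q (n + 1)),
          F (mSum q (n + 1) (x + ((k / q (n + 1) : ℝ) : UnitAddCircle)))
        = ∑ k ∈ Finset.range (q n * (2 * r)),
          F (mSum q (n + 1) (x + ((k / q (n + 1) : ℝ) : UnitAddCircle))) := by rw [hqr]
      _ = ∑ b ∈ Finset.range (2 * r), q n * walkMean n
            (fun z => F (z + haarT (q n • x + ((b / (2 * r : ℕ) : ℝ) : UnitAddCircle)))) := by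
          rw [sum_range_mul_add, Finset.sum_comm]
          refine Finset.sum_congr rfl fun b _ => ?_
          rw [← ih _ (x + ((b / q (n + 1) : ℝ) : UnitAddCircle))]
          exact Finset.sum_congr rfl fun a _ => by rw [hm]
      _ = q (n + 1) * walkMean (n + 1) F := by
          rw [sum_haarT_equidistributed hr₀
            (fun t => (q n : ℝ) * walkMean n (fun z => F (z + t))), walkMean_succ, hcast]
          simp only [← sub_eq_add_neg]
          ring

theorem integrable_comp_mSum (q : ℕ → ℕ) (n : ℕ) (F : ℤ → ℝ) :
    Integrable (fun x => F (mSum q n x)) (volume : Measure UnitAddCircle) := by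
  refine Integrable.of_bound
    (((measurable_of_countable F).comp (measurable_mSum q n)).aestronglyMeasurable)
    (∑ z ∈ Finset.Icc (-(n : ℤ)) n, ‖F z‖) (Filter.Eventually.of_forall fun x => ?_)
  exact Finset.single_le_sum (f := fun z => ‖F z‖) (fun _ _ => norm_nonneg _)
    (Finset.mem_Icc.2 (abs_le.1 (abs_mSum_le q n x)))

theorem integral_comp_mSum {q : ℕ → ℕ} {n : ℕ} (hpos : ∀ j ≤ n, 0 < q j)
    (hdvd : ∀ j < n, 2 * q j ∣ q (j + 1)) (F : ℤ → ℝ) :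
    ∫ x, F (mSum q n x) ∂(volume : Measure UnitAddCircle) = walkMean n F := by
  have hq : (q n : ℝ) ≠ 0 := by exact_mod_cast (hpos n le_rfl).ne'
  refine mul_left_cancel₀ hq ?_
  have hint := integrable_comp_mSum q n F
  calc (q n : ℝ) * ∫ x, F (mSum q n x) ∂(volume : Measure UnitAddCircle)
      = ∑ k ∈ Finset.range (q n), ∫ x, F (mSum q n (x + ((k / q n : ℝ) : UnitAddCircle)))
          ∂(volume : Measure UnitAddCircle) := by
        simp only [integral_add_right_eq_self (fun x => F (mSum q n x))]
        simp
    _ = ∫ x, ∑ k ∈ Finset.range (q n), F (mSum q n (x + ((k / q n : ℝ) : UnitAddCircle)))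
          ∂(volume : Measure UnitAddCircle) :=
        (integral_finsetSum _ fun k _ => hint.comp_add_right _).symm
    _ = q n * walkMean n F := by
        simp only [sum_mSum_translates hpos hdvd F]
        simp [Measure.real]

theorem sum_zmod_of_injOn {M : Type*} [AddCommMonoid M] {N : ℕ} [NeZero N] {s : Finset ℕ}
    (hs : s.card = N) {f : ℕ → ZMod N} (hf : Set.InjOn f s) (g : ZMod N → M) :
    ∑ k ∈ s, g (f k) = ∑ z, g z := by
  classical
  rw [← Finset.sum_image hf, Finset.eq_univ_of_card (s.image f)]
  rw [Finset.card_image_of_injOn hf, hs, ZMod.card]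

theorem sum_translates_coprime {M : Type*} [AddCommMonoid M] {N : ℕ} (hN : 0 < N) {p : ℤ}
    (hp : IsCoprime p (N : ℤ)) (g : UnitAddCircle → M) :
    ∑ k ∈ Finset.Icc 1 N, g (((k : ℝ) * (p : ℝ) / (N : ℝ) : ℝ) : UnitAddCircle) =
      ∑ k ∈ Finset.range N, g ((k / N : ℝ) : UnitAddCircle) := by
  have : NeZero N := ⟨hN.ne'⟩
  have hp' : IsUnit (p : ZMod N) := by
    obtain ⟨a, b, hab⟩ := hp
    refine .of_mul_eq_one (a : ZMod N) ?_
    have := congrArg (Int.cast : ℤ → ZMod N) hab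
    push_cast at this
    simpa [mul_comm] using this
  have h₁ : ∀ k : ℕ, (((k : ℝ) * (p : ℝ) / (N : ℝ) : ℝ) : UnitAddCircle) =
      ZMod.toAddCircle ((k : ZMod N) * (p : ZMod N)) := by
    intro k
    have := ZMod.toAddCircle_intCast (N := N) (k * p)
    push_cast at this
    exact this.symm
  have h₂ : ∀ k : ℕ, ((k / N : ℝ) : UnitAddCircle) = ZMod.toAddCircle (k : ZMod N) :=
    fun k => (ZMod.toAddCircle_natCast k).symm
  simp only [h₁, h₂]
  rw [sum_zmod_of_injOn (f := fun k => (k : ZMod N) * (p : ZMod N)) (by simp) ?_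
      (fun z => g (ZMod.toAddCircle z)),
    sum_zmod_of_injOn (f := fun k => (k : ZMod N)) (by simp) ?_ (fun z => g (ZMod.toAddCircle z))]
  · intro a ha b hb hab
    have ha := Finset.mem_range.1 ha
    have hb := Finset.mem_range.1 hb
    exact ((ZMod.natCast_eq_natCast_iff a b N).1 hab).eq_of_lt_of_lt ha hb
  · intro a ha b hb hab
    obtain ⟨ha₁, ha₂⟩ := Finset.mem_Icc.1 ha
    obtain ⟨hb₁, hb₂⟩ := Finset.mem_Icc.1 hb
    have hmod := (ZMod.natCast_eq_natCast_iff a b N).1 (hp'.mul_right_cancel hab)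
    rcases le_total a b with h | h
    · have hd := (Nat.modEq_iff_dvd' h).1 hmod
      have := Nat.eq_zero_of_dvd_of_lt hd (by omega)
      omega
    · have hd := (Nat.modEq_iff_dvd' h).1 hmod.symm
      have := Nat.eq_zero_of_dvd_of_lt hd (by omega)
      omega

theorem countN_eq {q : ℕ → ℕ} {n : ℕ} (hpos : ∀ j ≤ n, 0 < q j)
    (hdvd : ∀ j < n, 2 * q j ∣ q (j + 1)) {p : ℤ} (hp : IsCoprime p (q n : ℤ))
    (x : UnitAddCircle) : (countN q n p x : ℝ) = q n * walkProb n (mSum q n x) := by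
  classical
  unfold countN walkProb
  rw [← sum_mSum_translates hpos hdvd, ← sum_translates_coprime (hpos n le_rfl) hp
    (fun t => if mSum q n (x + t) = mSum q n x then (1 : ℝ) else 0), ← Finset.coe_filter,
    Set.ncard_coe_finset, Finset.sum_boole]

/-- there is a constant `C > 0` such that for every `n ≥ 1`, all positive
integers `q_1, …, q_{n+1}` (here `q j` is the paper's `q_{j+1}`) with `2q_j ∣ q_{j+1}`, and
every `p` coprime to `q_{n+1}`, the Renyi inequality
`∫_𝕋 N_n² dλ ≤ C·(∫_𝕋 N_n dλ)²` holds. -/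
theorem statement19 :
    ∃ C : ℝ, 0 < C ∧
      ∀ n : ℕ, 0 < n → ∀ q : ℕ → ℕ, (∀ j ≤ n, 0 < q j) →
        (∀ j < n, 2 * q j ∣ q (j + 1)) →
        ∀ p : ℤ, IsCoprime p (q n : ℤ) →
          (∫ x, (countN q n p x : ℝ) ^ 2 ∂(volume : Measure UnitAddCircle))
            ≤ C * (∫ x, (countN q n p x : ℝ) ∂(volume : Measure UnitAddCircle)) ^ 2 := by
  refine ⟨2, two_pos, fun n hn q hpos hdvd p hp => ?_⟩
  simp only [countN_eq hpos hdvd hp, mul_pow, integral_const_mul]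
  rw [integral_comp_mSum hpos hdvd (walkProb n),
    integral_comp_mSum hpos hdvd (fun z => walkProb n z ^ 2)]
  have h := mul_le_mul_of_nonneg_left (walkMean_walkProb_sq_le hn) (sq_nonneg (q n : ℝ))
  linarith
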